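/- Let G be a group of isometries of the Euclidean plane ℝ² that contains the reflection r in the y-axis and a nontrivial rotation about the origin. Let 𝒟 be the collection of all compact subsets of ℝ² that are homeomorphic to the closed unit disk, regarded as a metric space with the Hausdorff distance. Then there is no map c : 𝒟 → ℝ² that is continuous with respect to the Hausdorff distance, satisfies c(K) ∈ interior(K) (the topological interior of K in ℝ²) for every K ∈ 𝒟, and is G-equivariant: c(g • K) = g(c(K)) for every g ∈ G and K ∈ 𝒟, where g • K = {g(k) : k ∈ K}. -/

import Mathlib

open TopologicalSpace

/-- The collection of compact subsets of the Euclidean plane homeomorphic to the closed unit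
disk, metrized by the Hausdorff distance (as a subspace of the nonempty compact subsets with
the Hausdorff metric). -/
def DiskCollection : Type :=
  {K : NonemptyCompacts (EuclideanSpace ℝ (Fin 2)) //
    Nonempty ((K : Set (EuclideanSpace ℝ (Fin 2))) ≃ₜ
      (Metric.closedBall (0 : EuclideanSpace ℝ (Fin 2)) 1))}

noncomputable instance : MetricSpace DiskCollection :=
  inferInstanceAs (MetricSpace
    {K : NonemptyCompacts (EuclideanSpace ℝ (Fin 2)) //
      Nonempty ((K : Set (EuclideanSpace ℝ (Fin 2))) ≃ₜ
        (Metric.closedBall (0 : EuclideanSpace ℝ (Fin 2)) 1))})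

open Metric

/-- Compresses each vertical line at distance less than `w` from the `y`-axis towards height `-1`,
by a factor decreasing to `1/4` on the axis. The image of the unit disk is a disk with a slit. -/
noncomputable def slitMap (w : ℝ) (p : EuclideanSpace ℝ (Fin 2)) : EuclideanSpace ℝ (Fin 2) :=
  !₂[p 0, p 1 - max 0 (3 / 4 * (1 - |p 0| / w)) * (p 1 + 1)]

@[simp] lemma slitMap_apply_zero (w : ℝ) (p : EuclideanSpace ℝ (Fin 2)) :
    slitMap w p 0 = p 0 := by
  simp [slitMap]

@[simp] lemma slitMap_apply_one (w : ℝ) (p : EuclideanSpace ℝ (Fin 2)) :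
    slitMap w p 1 = p 1 - max 0 (3 / 4 * (1 - |p 0| / w)) * (p 1 + 1) := by
  simp [slitMap]

lemma continuous_slitMap (w : ℝ) : Continuous (slitMap w) := by
  unfold slitMap
  fun_prop

lemma slit_coefficient_le {w : ℝ} (hw : 0 < w) (x : ℝ) :
    max 0 (3 / 4 * (1 - |x| / w)) ≤ 3 / 4 := by
  have : 0 ≤ |x| / w := by positivity
  exact max_le (by norm_num) (by linarith)

lemma slitMap_injective {w : ℝ} (hw : 0 < w) : Function.Injective (slitMap w) := by
  intro p q h
  have h0 : p 0 = q 0 := by simpa using congrArg (fun v ↦ v 0) h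
  have h1 := congrArg (fun v ↦ v 1) h
  simp only [slitMap_apply_one, h0] at h1
  have ha := slit_coefficient_le hw (q 0)
  set a := max 0 (3 / 4 * (1 - |q 0| / w))
  have h2 : (1 - a) * (p 1 - q 1) = 0 := by linarith
  have h3 : p 1 = q 1 := by
    rcases mul_eq_zero.1 h2 with h | h <;> linarith
  ext i
  fin_cases i
  · exact h0
  · exact h3

lemma mem_closedBall_zero_one_iff (p : EuclideanSpace ℝ (Fin 2)) :
    p ∈ closedBall (0 : EuclideanSpace ℝ (Fin 2)) 1 ↔ p 0 ^ 2 + p 1 ^ 2 ≤ 1 := by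
  rw [mem_closedBall_zero_iff, EuclideanSpace.norm_eq, Real.sqrt_le_one]
  simp

lemma dist_le_abs_add_abs (p q : EuclideanSpace ℝ (Fin 2)) :
    dist p q ≤ |p 0 - q 0| + |p 1 - q 1| := by
  rw [EuclideanSpace.dist_eq, Real.sqrt_le_left (by positivity)]
  simp only [Fin.sum_univ_two, Real.dist_eq]
  nlinarith [mul_nonneg (abs_nonneg (p 0 - q 0)) (abs_nonneg (p 1 - q 1))]

/-- The image of the closed unit disk under a continuous injective map, as a disk. -/
noncomputable def diskImage (f : EuclideanSpace ℝ (Fin 2) → EuclideanSpace ℝ (Fin 2))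
    (hf : Continuous f) (hinj : Function.Injective f) : DiskCollection :=
  ⟨⟨⟨f '' closedBall 0 1, (isCompact_closedBall 0 1).image hf⟩,
    (nonempty_closedBall.2 zero_le_one).image f⟩,
    have : CompactSpace (closedBall (0 : EuclideanSpace ℝ (Fin 2)) 1) :=
      isCompact_iff_compactSpace.1 (isCompact_closedBall 0 1)
    ⟨(Continuous.homeoOfEquivCompactToT2
      (f := Equiv.Set.image f (closedBall 0 1) hinj)
      ((hf.comp continuous_subtype_val).subtype_mk _)).symm⟩⟩

@[simp] lemma coe_diskImage (f : EuclideanSpace ℝ (Fin 2) → EuclideanSpace ℝ (Fin 2))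
    (hf : Continuous f) (hinj : Function.Injective f) :
    ((diskImage f hf hinj).1 : Set (EuclideanSpace ℝ (Fin 2))) = f '' closedBall 0 1 :=
  rfl

lemma DiskCollection.dist_eq (K L : DiskCollection) :
    dist K L = hausdorffDist (K.1 : Set (EuclideanSpace ℝ (Fin 2))) L.1 :=
  rfl

lemma hausdorffDist_slitMap_image_le {w : ℝ} (hw : 0 < w) (hw1 : w ≤ 1) :
    hausdorffDist (slitMap w '' closedBall 0 1) (closedBall 0 1) ≤ 3 * w := by
  refine hausdorffDist_le_of_mem_dist (by positivity) ?_ ?_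
  · rintro _ ⟨p, hp, rfl⟩
    rw [mem_closedBall_zero_one_iff] at hp
    rcases le_or_gt w |p 0| with h | h
    · refine ⟨p, (mem_closedBall_zero_one_iff p).2 hp, ?_⟩
      have h1 : max 0 (3 / 4 * (1 - |p 0| / w)) = 0 := by
        refine max_eq_left ?_
        have := (one_le_div hw).2 h
        linarith
      refine (dist_le_abs_add_abs _ _).trans ?_
      simp only [slitMap_apply_zero, slitMap_apply_one, h1]
      simpa using hw.le
    · refine ⟨!₂[0, slitMap w p 1], ?_, ?_⟩
      · rw [mem_closedBall_zero_one_iff]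
        have ha := slit_coefficient_le hw (p 0)
        have ha0 : 0 ≤ max 0 (3 / 4 * (1 - |p 0| / w)) := le_max_left _ _
        simp only [slitMap_apply_one, Matrix.cons_val_zero, Matrix.cons_val_one]
        set a := max 0 (3 / 4 * (1 - |p 0| / w))
        have hy : p 1 ≤ 1 ∧ -1 ≤ p 1 := by constructor <;> nlinarith [sq_nonneg (p 0)]
        have h1 : -1 ≤ p 1 - a * (p 1 + 1) := by nlinarith
        have h2 : p 1 - a * (p 1 + 1) ≤ 1 := by nlinarith
        nlinarith
      · refine (dist_le_abs_add_abs _ _).trans ?_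
        simp
        linarith
  · intro p hp
    rw [mem_closedBall_zero_one_iff] at hp
    rcases le_or_gt w |p 0| with h | h
    · have h1 : max 0 (3 / 4 * (1 - |p 0| / w)) = 0 := by
        refine max_eq_left ?_
        have := (one_le_div hw).2 h
        linarith
      refine ⟨_, ⟨p, (mem_closedBall_zero_one_iff p).2 hp, rfl⟩, ?_⟩
      refine (dist_le_abs_add_abs _ _).trans ?_
      simp only [slitMap_apply_zero, slitMap_apply_one, h1]
      simpa using hw.le
    · have hy : p 1 ≤ 1 ∧ -1 ≤ p 1 := by constructor <;> nlinarith [sq_nonneg (p 0)]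
      refine ⟨_, ⟨!₂[w, (1 - w) * p 1], ?_, rfl⟩, ?_⟩
      · rw [mem_closedBall_zero_one_iff]
        simp only [Matrix.cons_val_zero, Matrix.cons_val_one]
        have : p 1 ^ 2 ≤ 1 := by nlinarith
        nlinarith [mul_le_mul_of_nonneg_left this (sq_nonneg (1 - w))]
      · refine (dist_le_abs_add_abs _ _).trans ?_
        have h1 : |p 0 - w| ≤ 2 * w := by
          rw [abs_lt] at h
          rw [abs_le]
          constructor <;> linarith
        have h2 : |p 1 - (1 - w) * p 1| ≤ w := by
          rw [abs_le]
          constructor <;> nlinarith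
        simp [abs_of_pos hw, div_self hw.ne']
        linarith

lemma image_closedBall_zero_of_map_zero
    (g : EuclideanSpace ℝ (Fin 2) ≃ᵢ EuclideanSpace ℝ (Fin 2)) (hg : g 0 = 0) :
    g '' closedBall 0 1 = closedBall 0 1 := by
  rw [g.image_closedBall, hg]

/-- A nontrivial rotation fixes only the origin. -/
lemma eq_zero_of_rotation_fixed
    (ρ : EuclideanSpace ℝ (Fin 2) ≃ᵢ EuclideanSpace ℝ (Fin 2)) (θ : ℝ)
    (hρ : ∀ p : EuclideanSpace ℝ (Fin 2),
      ρ p 0 = Real.cos θ * p 0 - Real.sin θ * p 1 ∧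
      ρ p 1 = Real.sin θ * p 0 + Real.cos θ * p 1)
    (hρ1 : ρ ≠ 1) {p : EuclideanSpace ℝ (Fin 2)} (hp : ρ p = p) : p = 0 := by
  have hcs := Real.sin_sq_add_cos_sq θ
  have hcos : Real.cos θ ≠ 1 := by
    intro hc
    have hs : Real.sin θ = 0 := by
      rw [hc] at hcs
      exact pow_eq_zero_iff two_ne_zero |>.1 (by linarith)
    refine hρ1 (IsometryEquiv.ext fun q ↦ ?_)
    ext i
    fin_cases i
    · simpa [hc, hs] using (hρ q).1
    · simpa [hc, hs] using (hρ q).2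
  obtain ⟨h0, h1⟩ := hρ p
  rw [hp] at h0 h1
  have hpos : 2 * (1 - Real.cos θ) ≠ 0 := mul_ne_zero two_ne_zero (sub_ne_zero.2 hcos.symm)
  have e0 : 2 * (1 - Real.cos θ) * p 0 = 0 := by
    linear_combination (1 - Real.cos θ) * h0 - Real.sin θ * h1 - p 0 * hcs
  have e1 : 2 * (1 - Real.cos θ) * p 1 = 0 := by
    linear_combination (1 - Real.cos θ) * h1 + Real.sin θ * h0 - p 1 * hcs
  ext i
  fin_cases i
  · exact (mul_eq_zero.1 e0).resolve_left hpos
  · exact (mul_eq_zero.1 e1).resolve_left hpos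

theorem no_hausdorff_continuous_equivariant_center
    (G : Subgroup (EuclideanSpace ℝ (Fin 2) ≃ᵢ EuclideanSpace ℝ (Fin 2)))
    (r : EuclideanSpace ℝ (Fin 2) ≃ᵢ EuclideanSpace ℝ (Fin 2)) (hrG : r ∈ G)
    (hr : ∀ p : EuclideanSpace ℝ (Fin 2), r p 0 = -(p 0) ∧ r p 1 = p 1)
    (ρ : EuclideanSpace ℝ (Fin 2) ≃ᵢ EuclideanSpace ℝ (Fin 2)) (hρG : ρ ∈ G) (θ : ℝ)
    (hρ : ∀ p : EuclideanSpace ℝ (Fin 2),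
      ρ p 0 = Real.cos θ * p 0 - Real.sin θ * p 1 ∧
      ρ p 1 = Real.sin θ * p 0 + Real.cos θ * p 1)
    (hρ1 : ρ ≠ 1) :
    ¬ ∃ c : DiskCollection → EuclideanSpace ℝ (Fin 2),
        Continuous c ∧
        (∀ K : DiskCollection, c K ∈ interior (K.1 : Set (EuclideanSpace ℝ (Fin 2)))) ∧
        (∀ g : EuclideanSpace ℝ (Fin 2) ≃ᵢ EuclideanSpace ℝ (Fin 2), g ∈ G →
          ∀ K L : DiskCollection,
            (L.1 : Set (EuclideanSpace ℝ (Fin 2))) =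
              g '' (K.1 : Set (EuclideanSpace ℝ (Fin 2))) →
            c L = g (c K)) := by
  rintro ⟨c, hc, hint, heq⟩
  set B : DiskCollection := diskImage id continuous_id Function.injective_id
  have hB : (B.1 : Set (EuclideanSpace ℝ (Fin 2))) = closedBall 0 1 := by simp [B]
  have hρ0 : ρ 0 = 0 := by
    ext i
    fin_cases i
    · simpa using (hρ 0).1
    · simpa using (hρ 0).2
  have hr0 : r 0 = 0 := by
    ext i
    fin_cases i
    · simpa using (hr 0).1
    · simpa using (hr 0).2
  have hcB : c B = 0 := by
    refine eq_zero_of_rotation_fixed ρ θ hρ hρ1 (heq ρ hρG B B ?_).symm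
    rw [hB, image_closedBall_zero_of_map_zero ρ hρ0]
  obtain ⟨δ, hδ, hclose⟩ := Metric.continuous_iff.1 hc B (1 / 2) (by norm_num)
  obtain ⟨w, hw, hwδ⟩ : ∃ w, 0 < w ∧ w < min 1 (δ / 3) := exists_between (by positivity)
  set K : DiskCollection := diskImage (slitMap w) (continuous_slitMap w) (slitMap_injective hw)
  have hK : (K.1 : Set (EuclideanSpace ℝ (Fin 2))) = slitMap w '' closedBall 0 1 := by simp [K]
  have hKB : dist K B < δ := by
    rw [DiskCollection.dist_eq, hK, hB]
    have h1 := hausdorffDist_slitMap_image_le hw (hwδ.le.trans (min_le_left _ _))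
    have h2 := hwδ.trans_le (min_le_right _ _)
    linarith
  have hcomm (p : EuclideanSpace ℝ (Fin 2)) : r (slitMap w p) = slitMap w (r p) := by
    ext i
    fin_cases i
    · simp [(hr _).1]
    · simp [(hr _).1, (hr _).2]
  have hcK : r (c K) = c K := by
    refine (heq r hrG K K ?_).symm
    rw [hK, Set.image_image]
    simp only [hcomm]
    rw [← Set.image_image (slitMap w) r, image_closedBall_zero_of_map_zero r hr0]
  have hx : c K 0 = 0 := by
    have := (hr (c K)).1
    rw [hcK] at this
    linarith
  obtain ⟨p, hp, hpK⟩ : c K ∈ slitMap w '' closedBall 0 1 := hK ▸ interior_subset (hint K)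
  have hp0 : p 0 = 0 := by rw [← hx, ← hpK, slitMap_apply_zero]
  have hy : c K 1 ≤ -(1 / 2) := by
    rw [mem_closedBall_zero_one_iff] at hp
    rw [← hpK, slitMap_apply_one, hp0]
    norm_num
    nlinarith
  have hdist := hclose K hKB
  rw [hcB, dist_zero_right] at hdist
  have hnorm := PiLp.norm_apply_le (c K) 1
  rw [Real.norm_eq_abs] at hnorm
  linarith [neg_abs_le (c K 1)]
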